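/- Fix x ∈ ℝ², t ∈ ℝ, Δt > 0. Let v : ℝ² → ℝ² be differentiable at x with Jacobian matrix Dv(x) ∈ ℝ^{2×2}, and write γ(s) := det(I₂ − s·Dv(x)). Let φ : ℝ² × ℝ → ℝ be differentiable at (x,t), and suppose the function g(s) := φ(x − s·v(x), t − s)·γ(s) is three times differentiable on [0, 2Δt] with |g'''(s)| ≤ M for all s ∈ [0, 2Δt]. Then | (3φ(x,t) − 4φ(x − Δt·v(x), t − Δt)·det(I₂ − Δt·Dv(x)) + φ(x − 2Δt·v(x), t − 2Δt)·det(I₂ − 2Δt·Dv(x)))/(2Δt) − (∂φ/∂t(x,t) + v(x)·∇φ(x,t) + φ(x,t)·div v(x)) | ≤ M·Δt²; i.e., the two-step Jacobian-weighted characteristic discretization of the conservative material derivative ∂φ/∂t + ∇·(vφ) is second-order accurate in time. -/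

import Mathlib

open Set

/-- The determinant of `1 - s • A` has derivative `-tr A` at `s = 0`. -/
theorem LinearMap.hasDerivAt_det_id_sub_smul {E : Type*} [AddCommGroup E] [Module ℝ E]
    [Module.Finite ℝ E] (A : E →ₗ[ℝ] E) :
    HasDerivAt (fun s : ℝ => LinearMap.det ((LinearMap.id : E →ₗ[ℝ] E) - s • A))
      (-LinearMap.trace ℝ E A) 0 := by
  classical
  let b := Module.finBasis ℝ E
  have hdet : (fun s : ℝ => LinearMap.det ((LinearMap.id : E →ₗ[ℝ] E) - s • A)) =
      fun s : ℝ => Polynomial.eval (-s)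
        (Matrix.det (1 + (Polynomial.X : Polynomial ℝ) •
          (LinearMap.toMatrix b b A).map Polynomial.C)) := by
    funext s
    rw [← LinearMap.det_toMatrix b, map_sub, LinearMap.toMatrix_id, map_smul,
      ← Polynomial.coe_evalRingHom, RingHom.map_det]
    congr 1
    ext i j
    by_cases h : i = j <;> simp [h, sub_eq_add_neg] <;> ring
  rw [hdet, LinearMap.trace_eq_matrix_trace ℝ b, ← Matrix.derivative_det_one_add_X_smul]
  have h := (Polynomial.hasDerivAt (Matrix.det (1 + (Polynomial.X : Polynomial ℝ) •
    (LinearMap.toMatrix b b A).map Polynomial.C)) (-(0 : ℝ))).comp (0 : ℝ) (hasDerivAt_neg 0)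
  simpa [Function.comp_def] using h

/-- A function vanishing at `0` whose derivative is at most `C * s ^ n` in absolute value is
itself at most `C * s ^ (n + 1) / (n + 1)` in absolute value. -/
theorem abs_le_pow_succ_of_abs_deriv_le_pow {f f' : ℝ → ℝ} {b C : ℝ} (n : ℕ)
    (hf : ∀ s ∈ Icc (0 : ℝ) b, HasDerivWithinAt f (f' s) (Icc (0 : ℝ) b) s) (hf0 : f 0 = 0)
    (hbound : ∀ s ∈ Icc (0 : ℝ) b, |f' s| ≤ C * s ^ n) :
    ∀ s ∈ Icc (0 : ℝ) b, |f s| ≤ C / (n + 1) * s ^ (n + 1) := by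
  have hn : (n + 1 : ℝ) ≠ 0 := by positivity
  intro s hs
  refine image_norm_le_of_norm_deriv_right_le_deriv_boundary (f := f) (f' := f')
    (B := fun s => C / (n + 1) * s ^ (n + 1)) (B' := fun s => C * s ^ n)
    (fun s hs => (hf s hs).continuousWithinAt)
    (fun s hs => ?_) (by simp [hf0]) (fun s => ?_)
    (fun s hs => hbound s (Ico_subset_Icc_self hs)) hs
  · exact (hf s (Ico_subset_Icc_self hs)).mono_of_mem_nhdsWithin (Icc_mem_nhdsGE_of_mem hs)
  · have h := (hasDerivAt_pow (n + 1) s).const_mul (C / (n + 1))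
    refine h.congr_deriv ?_
    rw [Nat.cast_add_one, Nat.add_sub_cancel, ← mul_assoc, div_mul_cancel₀ _ hn]

/-- Second-order Taylor expansion at `0` with the sharp remainder bound. -/
theorem abs_sub_taylor_two_le {g g' g'' g''' : ℝ → ℝ} {b M : ℝ}
    (hg' : ∀ s ∈ Icc (0 : ℝ) b, HasDerivWithinAt g (g' s) (Icc (0 : ℝ) b) s)
    (hg'' : ∀ s ∈ Icc (0 : ℝ) b, HasDerivWithinAt g' (g'' s) (Icc (0 : ℝ) b) s)
    (hg''' : ∀ s ∈ Icc (0 : ℝ) b, HasDerivWithinAt g'' (g''' s) (Icc (0 : ℝ) b) s)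
    (hM : ∀ s ∈ Icc (0 : ℝ) b, |g''' s| ≤ M) :
    ∀ s ∈ Icc (0 : ℝ) b,
      |g s - (g 0 + g' 0 * s + g'' 0 / 2 * s ^ 2)| ≤ M / 6 * s ^ 3 := by
  have h₂ := abs_le_pow_succ_of_abs_deriv_le_pow (f := fun s => g'' s - g'' 0) (C := M) 0
    (fun s hs => (hg''' s hs).sub_const _) (by simp) (by simpa using hM)
  have h₁ := abs_le_pow_succ_of_abs_deriv_le_pow
    (f := fun s => g' s - (g' 0 + g'' 0 * s)) _
    (fun s hs => by
      have h := (hg'' s hs).sub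
        (((hasDerivWithinAt_id s (Icc 0 b)).const_mul (g'' 0)).const_add (g' 0))
      refine h.congr_deriv (g' := g'' s - g'' 0) ?_
      ring) (by simp) h₂
  have h₀ := abs_le_pow_succ_of_abs_deriv_le_pow
    (f := fun s => g s - (g 0 + g' 0 * s + g'' 0 / 2 * s ^ 2)) _
    (fun s hs => by
      have h := (hg' s hs).sub
        ((((hasDerivWithinAt_id s (Icc 0 b)).const_mul (g' 0)).const_add (g 0)).add
          (((hasDerivAt_pow 2 s).hasDerivWithinAt (s := Icc 0 b)).const_mul (g'' 0 / 2)))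
      refine h.congr_deriv (g' := g' s - (g' 0 + g'' 0 * s)) ?_
      push_cast
      ring) (by simp) h₁
  intro s hs
  refine (h₀ s hs).trans_eq ?_
  push_cast
  ring

/-- The one-sided BDF2 difference quotient approximates `-g' 0` to second order. -/
theorem abs_bdf_two_add_deriv_le {g g' g'' g''' : ℝ → ℝ} {h M : ℝ} (hh : 0 < h)
    (hg' : ∀ s ∈ Icc (0 : ℝ) (2 * h), HasDerivWithinAt g (g' s) (Icc (0 : ℝ) (2 * h)) s)
    (hg'' : ∀ s ∈ Icc (0 : ℝ) (2 * h), HasDerivWithinAt g' (g'' s) (Icc (0 : ℝ) (2 * h)) s)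
    (hg''' : ∀ s ∈ Icc (0 : ℝ) (2 * h), HasDerivWithinAt g'' (g''' s) (Icc (0 : ℝ) (2 * h)) s)
    (hM : ∀ s ∈ Icc (0 : ℝ) (2 * h), |g''' s| ≤ M) :
    |(3 * g 0 - 4 * g h + g (2 * h)) / (2 * h) + g' 0| ≤ M * h ^ 2 := by
  have hT := abs_sub_taylor_two_le hg' hg'' hg''' hM
  have h₁ := abs_le.mp (hT h ⟨hh.le, by linarith⟩)
  have h₂ := abs_le.mp (hT (2 * h) ⟨by linarith, le_rfl⟩)
  have hrw : (3 * g 0 - 4 * g h + g (2 * h)) / (2 * h) + g' 0 =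
      (3 * g 0 - 4 * g h + g (2 * h) + 2 * h * g' 0) / (2 * h) := by
    field_simp
  rw [hrw, abs_div, abs_of_pos (by positivity : 0 < 2 * h), div_le_iff₀ (by positivity), abs_le]
  constructor <;> nlinarith [h₁.1, h₁.2, h₂.1, h₂.2]

/-- The two-step (BDF2-type) Jacobian-weighted characteristic discretization of the
conservative material derivative `∂φ/∂t + ∇·(vφ) = ∂φ/∂t + v·∇φ + φ div v` is
second-order accurate in time. Here `γ s = det (I₂ - s • Dv(x))` and
`div v(x) = tr (Dv(x))`. -/
theorem stmt_4
    (x : EuclideanSpace ℝ (Fin 2)) (t : ℝ) (Δt : ℝ) (hΔt : 0 < Δt)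
    (v : EuclideanSpace ℝ (Fin 2) → EuclideanSpace ℝ (Fin 2))
    (hv : DifferentiableAt ℝ v x)
    (φ : EuclideanSpace ℝ (Fin 2) × ℝ → ℝ)
    (hφ : DifferentiableAt ℝ φ (x, t))
    (γ : ℝ → ℝ)
    (hγ : γ = fun s : ℝ => LinearMap.det
      ((LinearMap.id : EuclideanSpace ℝ (Fin 2) →ₗ[ℝ] EuclideanSpace ℝ (Fin 2))
        - s • (fderiv ℝ v x : EuclideanSpace ℝ (Fin 2) →ₗ[ℝ] EuclideanSpace ℝ (Fin 2))))
    (g' g'' g''' : ℝ → ℝ) (M : ℝ)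
    (hg' : ∀ s ∈ Icc (0:ℝ) (2 * Δt),
      HasDerivWithinAt (fun s : ℝ => φ (x - s • v x, t - s) * γ s) (g' s)
        (Icc (0:ℝ) (2 * Δt)) s)
    (hg'' : ∀ s ∈ Icc (0:ℝ) (2 * Δt), HasDerivWithinAt g' (g'' s) (Icc (0:ℝ) (2 * Δt)) s)
    (hg''' : ∀ s ∈ Icc (0:ℝ) (2 * Δt), HasDerivWithinAt g'' (g''' s) (Icc (0:ℝ) (2 * Δt)) s)
    (hM : ∀ s ∈ Icc (0:ℝ) (2 * Δt), |g''' s| ≤ M) :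
    |(3 * φ (x, t) - 4 * φ (x - Δt • v x, t - Δt) * γ Δt
          + φ (x - (2 * Δt) • v x, t - 2 * Δt) * γ (2 * Δt)) / (2 * Δt)
        - (fderiv ℝ φ (x, t) (0, 1) + fderiv ℝ φ (x, t) (v x, 0)
          + φ (x, t) * LinearMap.trace ℝ (EuclideanSpace ℝ (Fin 2))
              (fderiv ℝ v x : EuclideanSpace ℝ (Fin 2) →ₗ[ℝ] EuclideanSpace ℝ (Fin 2)))|
      ≤ M * Δt ^ 2 := by
  have hγ0 : γ 0 = 1 := by simp [hγ]
  have hγd := LinearMap.hasDerivAt_det_id_sub_smul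
    (fderiv ℝ v x : EuclideanSpace ℝ (Fin 2) →ₗ[ℝ] EuclideanSpace ℝ (Fin 2))
  rw [← hγ] at hγd
  have hpath : HasDerivAt (fun s : ℝ => (x - s • v x, t - s)) (-v x, (-1 : ℝ)) 0 := by
    refine HasDerivAt.prodMk ?_ ((hasDerivAt_id (0 : ℝ)).const_sub t)
    simpa using ((hasDerivAt_id (0 : ℝ)).smul_const (v x)).const_sub x
  have hφd : HasDerivAt (fun s : ℝ => φ (x - s • v x, t - s))
      (fderiv ℝ φ (x, t) (-v x, -1)) 0 :=
    HasFDerivAt.comp_hasDerivAt (0 : ℝ) (by simpa using hφ.hasFDerivAt) hpath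
  have hmem : (0 : ℝ) ∈ Icc (0 : ℝ) (2 * Δt) := ⟨le_rfl, by positivity⟩
  have hderiv : g' 0 = fderiv ℝ φ (x, t) (-v x, -1) * γ 0 + φ (x - (0 : ℝ) • v x, t - 0) *
      -LinearMap.trace ℝ (EuclideanSpace ℝ (Fin 2)) (fderiv ℝ v x) :=
    (uniqueDiffOn_Icc (by positivity) 0 hmem).eq_deriv _ (hg' 0 hmem)
      (hφd.mul hγd).hasDerivWithinAt
  have hsplit : ((-v x, -1) : EuclideanSpace ℝ (Fin 2) × ℝ) = -((0, 1) + (v x, 0)) := by simp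
  rw [hsplit, map_neg, map_add, hγ0] at hderiv
  simp only [zero_smul, sub_zero] at hderiv
  have hmain := abs_bdf_two_add_deriv_le hΔt hg' hg'' hg''' hM
  simp only [zero_smul, sub_zero, hγ0, mul_one, hderiv] at hmain
  convert hmain using 2
  ring
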